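/- Let φ : ℚ_p → ℝ be a test function with ∫_{ℚ_p} φ dμ = 0. Then the double integral B(φ, φ) = −((p−1)/(p ln p)) ∫_{ℚ_p} ∫_{ℚ_p} φ(x) · ln|x − y|_p · φ(y) dμ(y) dμ(x) converges absolutely, B(φ, φ) ≥ 0, and B(φ, φ) = 0 if and only if φ is identically zero. (B is the quadratic form φ ↦ ⟨φ, D^{-1} φ⟩ associated with the inverse Vladimirov operator; its positivity makes exp(−B(f,f)/2) a characteristic functional of a Gaussian measure.) -/

import Mathlib

open MeasureTheory

/-- A (Bruhat–Schwartz) test function on `ℚ_[p]`: locally constant with compact support. -/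
def IsTestFunction {p : ℕ} [Fact p.Prime] (φ : ℚ_[p] → ℝ) : Prop :=
  (∀ x : ℚ_[p], ∃ l : ℤ, ∀ x' : ℚ_[p], ‖x'‖ ≤ (p : ℝ) ^ (-l) → φ (x + x') = φ x) ∧
  HasCompactSupport φ

section PadicLogEnergy

open Set Filter Topology

variable {p : ℕ} [Fact p.Prime]

theorem IsTestFunction.exists_forall_norm_sub_lt {φ : ℚ_[p] → ℝ} (hφ : IsTestFunction φ) :
    ∃ δ > 0, ∀ x y : ℚ_[p], ‖x - y‖ < δ → φ x = φ y := by
  obtain ⟨hloc, hcs⟩ := hφ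
  choose l hl using hloc
  have hp : (0 : ℝ) < p := by exact_mod_cast (Fact.out : p.Prime).pos
  have hball : ∀ c y, y ∈ Metric.ball c ((p : ℝ) ^ (-l c)) → φ y = φ c := by
    intro c y hy
    have := hl c (y - c) (by
      rw [← dist_eq_norm]
      exact (Metric.mem_ball.1 hy).le)
    simpa using this
  obtain ⟨δ, hδ, h⟩ := lebesgue_number_lemma_of_metric (s := tsupport φ)
    (c := fun x => Metric.ball x ((p : ℝ) ^ (-l x))) hcs (fun _ => Metric.isOpen_ball)
    (fun x _ => mem_iUnion.2 ⟨x, Metric.mem_ball_self (zpow_pos hp _)⟩)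
  have key : ∀ x ∈ tsupport φ, ∀ y, ‖x - y‖ < δ → φ x = φ y := by
    intro x hx y hxy
    obtain ⟨i, hi⟩ := h x hx
    rw [hball i x (hi (Metric.mem_ball_self hδ)),
      hball i y (hi (by rwa [Metric.mem_ball, dist_comm, dist_eq_norm]))]
  refine ⟨δ, hδ, fun x y hxy => ?_⟩
  by_cases hx : x ∈ tsupport φ
  · exact key x hx y hxy
  by_cases hy : y ∈ tsupport φ
  · exact (key y hy x (by rwa [norm_sub_rev])).symm
  rw [image_eq_zero_of_notMem_tsupport hx, image_eq_zero_of_notMem_tsupport hy]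

theorem IsTestFunction.continuous {φ : ℚ_[p] → ℝ} (hφ : IsTestFunction φ) : Continuous φ := by
  obtain ⟨δ, hδ, h⟩ := hφ.exists_forall_norm_sub_lt
  refine Metric.continuous_iff.2 fun x ε hε => ⟨δ, hδ, fun y hy => ?_⟩
  rw [h y x (by rwa [← dist_eq_norm]), dist_self]
  exact hε

theorem IsTestFunction.exists_norm_le_zpow {φ : ℚ_[p] → ℝ} (hφ : IsTestFunction φ) :
    ∃ N : ℤ, ∀ x, φ x ≠ 0 → ‖x‖ ≤ (p : ℝ) ^ N := by
  have hp : (1 : ℝ) < p := by exact_mod_cast (Fact.out : p.Prime).one_lt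
  obtain ⟨R, hR⟩ := hφ.2.isCompact.isBounded.exists_norm_le
  obtain ⟨N, hN⟩ := pow_unbounded_of_one_lt R hp
  exact ⟨N, fun x hx => (hR x (subset_tsupport φ hx)).trans (by simpa using hN.le)⟩

theorem Padic.norm_sub_le_max (x y : ℚ_[p]) : ‖x - y‖ ≤ max ‖x‖ ‖y‖ := by
  simpa [sub_eq_add_neg] using IsUltrametricDist.norm_add_le_max x (-y)

theorem Padic.exists_norm_eq_zpow {z : ℚ_[p]} (hz : z ≠ 0) : ∃ k : ℤ, ‖z‖ = (p : ℝ) ^ k :=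
  ⟨_, Padic.norm_eq_zpow_neg_valuation hz⟩

variable [MeasurableSpace ℚ_[p]] [BorelSpace ℚ_[p]] (μ : Measure ℚ_[p]) [μ.IsAddHaarMeasure]

theorem Padic.measurableSet_norm_le (r : ℝ) : MeasurableSet {z : ℚ_[p] | ‖z‖ ≤ r} :=
  measurableSet_le measurable_norm measurable_const

omit [BorelSpace ℚ_[p]] in
theorem Padic.measure_norm_le_lt_top (r : ℝ) : μ {z : ℚ_[p] | ‖z‖ ≤ r} < ⊤ := by
  have : {z : ℚ_[p] | ‖z‖ ≤ r} = Metric.closedBall 0 r := by ext; simp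
  rw [this]
  exact (isCompact_closedBall _ _).measure_lt_top

omit [BorelSpace ℚ_[p]] in
theorem Padic.measureReal_norm_le_pos {r : ℝ} (hr : 0 < r) :
    0 < μ.real {z : ℚ_[p] | ‖z‖ ≤ r} := by
  have : {z : ℚ_[p] | ‖z‖ ≤ r} = Metric.closedBall 0 r := by ext; simp
  refine ENNReal.toReal_pos ?_ (Padic.measure_norm_le_lt_top μ r).ne
  rw [this]
  exact (Metric.measure_closedBall_pos μ _ hr).ne'

theorem Padic.two_mul_measure_norm_le_zpow_sub_one (k : ℤ) :
    2 * μ {z : ℚ_[p] | ‖z‖ ≤ (p : ℝ) ^ (k - 1)} ≤ μ {z : ℚ_[p] | ‖z‖ ≤ (p : ℝ) ^ k} := by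
  have hp : (1 : ℝ) < p := by exact_mod_cast (Fact.out : p.Prime).one_lt
  have hlt : (p : ℝ) ^ (k - 1) < (p : ℝ) ^ k := zpow_lt_zpow_right₀ hp (by lia)
  set B := {z : ℚ_[p] | ‖z‖ ≤ (p : ℝ) ^ (k - 1)}
  set c : ℚ_[p] := (p : ℚ_[p]) ^ (-k)
  have hc : ‖c‖ = (p : ℝ) ^ k := by simp [c]
  have hBm : MeasurableSet B := Padic.measurableSet_norm_le _
  have hdisj : Disjoint ((fun z => z - c) ⁻¹' B) B := by
    refine Set.disjoint_left.2 fun z hz hz' => ?_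
    have h1 : ‖z - (z - c)‖ ≤ max ‖z‖ ‖z - c‖ := Padic.norm_sub_le_max _ _
    rw [sub_sub_cancel, hc] at h1
    exact absurd (h1.trans (max_le hz' hz)) (not_le.2 hlt)
  calc 2 * μ B = μ ((fun z => z - c) ⁻¹' B) + μ B := by
        simp_rw [sub_eq_add_neg]
        rw [measure_preimage_add_right, two_mul]
    _ = μ ((fun z => z - c) ⁻¹' B ∪ B) := (measure_union hdisj hBm).symm
    _ ≤ _ := by
        refine measure_mono (union_subset (fun z hz => ?_) fun z hz => le_trans hz hlt.le)
        have h1 : ‖(z - c) + c‖ ≤ max ‖z - c‖ ‖c‖ := IsUltrametricDist.norm_add_le_max _ _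
        rw [sub_add_cancel] at h1
        exact h1.trans (max_le (le_trans hz hlt.le) hc.le)

theorem Padic.measure_norm_le_zpow_sub_le (N : ℤ) (i : ℕ) :
    μ {z : ℚ_[p] | ‖z‖ ≤ (p : ℝ) ^ (N - i)} ≤
      2⁻¹ ^ i * μ {z : ℚ_[p] | ‖z‖ ≤ (p : ℝ) ^ N} := by
  induction i with
  | zero => simp
  | succ i ih =>
    have h := Padic.two_mul_measure_norm_le_zpow_sub_one μ (N - i)
    rw [show N - ((i + 1 : ℕ) : ℤ) = N - i - 1 by push_cast; ring, pow_succ', mul_assoc]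
    calc _ = 2⁻¹ * (2 * μ {z : ℚ_[p] | ‖z‖ ≤ (p : ℝ) ^ (N - i - 1)}) := by
          rw [← mul_assoc, ENNReal.inv_mul_cancel (by simp) (by simp), one_mul]
      _ ≤ _ := by exact mul_le_mul_right (h.trans ih) _

theorem Padic.integrableOn_log_norm (N : ℤ) :
    IntegrableOn (fun z : ℚ_[p] => Real.log ‖z‖) {z | ‖z‖ ≤ (p : ℝ) ^ N} μ := by
  have hp : (1 : ℝ) < p := by exact_mod_cast (Fact.out : p.Prime).one_lt
  have hlog : 0 < Real.log p := Real.log_pos hp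
  set B := {z : ℚ_[p] | ‖z‖ ≤ (p : ℝ) ^ N}
  have hBm : MeasurableSet B := Padic.measurableSet_norm_le _
  have hBt := Padic.measure_norm_le_lt_top μ ((p : ℝ) ^ N)
  have hm : Measurable fun z : ℚ_[p] => N * Real.log p - Real.log ‖z‖ :=
    measurable_const.sub (Real.measurable_log.comp measurable_norm)
  suffices h : IntegrableOn (fun z : ℚ_[p] => N * Real.log p - Real.log ‖z‖) B μ by
    have h2 := (integrableOn_const (C := N * Real.log p) hBt.ne).sub h
    exact h2.congr (Eventually.of_forall fun z => by simp)
  refine ⟨hm.aestronglyMeasurable, ?_⟩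
  have hle : ∀ᵐ z ∂μ.restrict B, ‖N * Real.log p - Real.log ‖z‖‖ₑ ≤
      ∑' i : ℕ, ENNReal.ofReal (Real.log p) *
        {z : ℚ_[p] | ‖z‖ ≤ (p : ℝ) ^ (N - i)}.indicator 1 z := by
    have h0 : ∀ᵐ z ∂μ.restrict B, z ≠ 0 := ae_restrict_of_ae (measure_eq_zero_iff_ae_notMem.1
      (measure_singleton (μ := μ) (0 : ℚ_[p])))
    filter_upwards [h0, ae_restrict_mem hBm] with z hz hzB
    obtain ⟨k, hk⟩ := Padic.exists_norm_eq_zpow hz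
    have hkN : k ≤ N := by
      have : ‖z‖ ≤ (p : ℝ) ^ N := hzB
      rwa [hk, zpow_le_zpow_iff_right₀ hp] at this
    obtain ⟨m, hm⟩ := Int.eq_ofNat_of_zero_le (sub_nonneg.2 hkN)
    refine le_trans ?_ (ENNReal.sum_le_tsum (Finset.range m))
    have hsum : ∀ i ∈ Finset.range m, ENNReal.ofReal (Real.log p) *
        {z : ℚ_[p] | ‖z‖ ≤ (p : ℝ) ^ (N - i)}.indicator 1 z = ENNReal.ofReal (Real.log p) := by
      intro i hi
      have hi' : i < m := Finset.mem_range.1 hi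
      rw [indicator_of_mem, Pi.one_apply, mul_one]
      change ‖z‖ ≤ _
      rw [hk, zpow_le_zpow_iff_right₀ hp]
      lia
    rw [Finset.sum_congr rfl hsum, Finset.sum_const, Finset.card_range, hk, Real.log_zpow,
      ← sub_mul, ← Int.cast_sub, hm, Real.enorm_eq_ofReal (by positivity),
      ← ENNReal.ofReal_nsmul]
    simp
  refine (lintegral_mono_ae hle).trans_lt ((setLIntegral_le_lintegral _ _).trans_lt ?_)
  rw [lintegral_tsum (fun i => ((measurable_one.indicator
    (Padic.measurableSet_norm_le _)).const_mul _).aemeasurable)]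
  calc _ ≤ ∑' i : ℕ, ENNReal.ofReal (Real.log p) * (2⁻¹ ^ i * μ B) := by
        refine ENNReal.tsum_le_tsum fun i => ?_
        rw [lintegral_const_mul _ (measurable_one.indicator (Padic.measurableSet_norm_le _)),
          lintegral_indicator_one (Padic.measurableSet_norm_le _)]
        gcongr
        exact Padic.measure_norm_le_zpow_sub_le μ N i
    _ < ⊤ := by
        rw [ENNReal.tsum_mul_left, ENNReal.tsum_mul_right, ENNReal.tsum_geometric]
        refine ENNReal.mul_lt_top ENNReal.ofReal_lt_top (ENNReal.mul_lt_top ?_ hBt)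
        simp

theorem Padic.integrable_indicator_norm_le (r : ℝ) :
    Integrable ({z : ℚ_[p] | ‖z‖ ≤ r}.indicator (1 : ℚ_[p] → ℝ)) μ :=
  (integrable_indicator_iff (Padic.measurableSet_norm_le r)).2
    (integrableOn_const (C := (1 : ℝ)) (Padic.measure_norm_le_lt_top μ r).ne)

omit [μ.IsAddHaarMeasure] in
theorem Padic.integral_indicator_norm_le (r : ℝ) :
    ∫ z, {z : ℚ_[p] | ‖z‖ ≤ r}.indicator (1 : ℚ_[p] → ℝ) z ∂μ = μ.real {z : ℚ_[p] | ‖z‖ ≤ r} :=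
  integral_indicator_one (Padic.measurableSet_norm_le r)

variable {μ} {φ : ℚ_[p] → ℝ}

theorem IsTestFunction.integrable (hφ : IsTestFunction φ) : Integrable φ μ :=
  hφ.continuous.integrable_of_hasCompactSupport hφ.2

theorem IsTestFunction.integrable_mul_sub_mul (hφ : IsTestFunction φ) {k : ℚ_[p] → ℝ}
    (hk : Integrable k μ) :
    Integrable (fun q : ℚ_[p] × ℚ_[p] => φ q.1 * k (q.1 - q.2) * φ q.2) (μ.prod μ) := by
  obtain ⟨C, hC⟩ := hφ.2.exists_bound_of_continuous hφ.continuous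
  have h := (hφ.integrable (μ := μ)).convolution_integrand (ContinuousLinearMap.mul ℝ ℝ) hk
  have h2 := h.bdd_mul (c := C) (f := fun q : ℚ_[p] × ℚ_[p] => φ q.1)
    (hφ.continuous.comp continuous_fst).aestronglyMeasurable
    (Eventually.of_forall fun q => hC q.1)
  refine h2.congr (Eventually.of_forall fun q => ?_)
  simp only [ContinuousLinearMap.mul_apply']
  ring

/-- The form is positive on indicators of balls, since convolving with the normalized indicator of
a ball around zero is an orthogonal projection. -/
theorem IsTestFunction.integral_indicator_nonneg (hφ : IsTestFunction φ) {r : ℝ} (hr : 0 < r) :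
    0 ≤ ∫ q : ℚ_[p] × ℚ_[p], φ q.1 *
      {z : ℚ_[p] | ‖z‖ ≤ r}.indicator (1 : ℚ_[p] → ℝ) (q.1 - q.2) * φ q.2 ∂(μ.prod μ) := by
  set k := {z : ℚ_[p] | ‖z‖ ≤ r}.indicator (1 : ℚ_[p] → ℝ) with hkdef
  have hk : Integrable k μ := Padic.integrable_indicator_norm_le μ r
  have hint := hφ.integrable_mul_sub_mul hk
  set A : ℚ_[p] → ℝ := fun x => ∫ y, k (x - y) * φ y ∂μ with hA
  have hφA : Integrable (fun x => φ x * A x) μ := by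
    refine hint.integral_prod_left.congr (Eventually.of_forall fun x => ?_)
    simp only [hA, mul_assoc, integral_const_mul]
  have hE : ∫ q : ℚ_[p] × ℚ_[p], φ q.1 * k (q.1 - q.2) * φ q.2 ∂(μ.prod μ)
      = ∫ x, φ x * A x ∂μ := by
    rw [integral_prod _ hint]
    simp only [hA, mul_assoc, integral_const_mul]
  have hmem : ∀ z x : ℚ_[p], ‖z - x‖ ≤ r → ∀ y, k (z - y) = k (x - y) := by
    intro z x hzx y
    have h1 : ‖z - y‖ ≤ r ↔ ‖x - y‖ ≤ r := by
      constructor <;> intro h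
      · have := Padic.norm_sub_le_max (z - y) (z - x)
        rw [sub_sub_sub_cancel_left] at this
        exact this.trans (max_le h hzx)
      · have := IsUltrametricDist.norm_add_le_max (z - x) (x - y)
        rw [sub_add_sub_cancel] at this
        exact this.trans (max_le hzx h)
    simp only [hkdef, indicator_apply, mem_ofPred_eq, h1, Pi.one_apply]
  have hAA : ∀ z x : ℚ_[p], k (z - x) * φ x * A z = φ x * A x * k (z - x) := by
    intro z x
    by_cases h : ‖z - x‖ ≤ r
    · have : A z = A x := by simp only [hA, hmem z x h]
      rw [this]; ring
    · have : k (z - x) = 0 := indicator_of_notMem (s := {z | ‖z‖ ≤ r}) h _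
      simp [this]
  have hsq : ∫ z, A z ^ 2 ∂μ = μ.real {z : ℚ_[p] | ‖z‖ ≤ r} * ∫ x, φ x * A x ∂μ := by
    calc ∫ z, A z ^ 2 ∂μ = ∫ z, ∫ x, φ x * A x * k (z - x) ∂μ ∂μ := by
          congr 1; ext z
          simp_rw [← hAA z, integral_mul_const, sq]
          rfl
      _ = ∫ x, ∫ z, φ x * A x * k (z - x) ∂μ ∂μ :=
          integral_integral_swap (hφA.convolution_integrand (ContinuousLinearMap.mul ℝ ℝ) hk)
      _ = _ := by
          simp_rw [integral_const_mul, integral_sub_right_eq_self k, integral_mul_const]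
          rw [hkdef, Padic.integral_indicator_norm_le, mul_comm]
  rw [hE]
  have hpos := Padic.measureReal_norm_le_pos μ hr
  have : 0 ≤ ∫ z, A z ^ 2 ∂μ := integral_nonneg fun z => sq_nonneg _
  rw [hsq] at this
  exact nonneg_of_mul_nonneg_right this hpos

theorem IsTestFunction.integral_mul_sub_mul_of_support (hφ : IsTestFunction φ) {k : ℚ_[p] → ℝ}
    (hk : Integrable k μ) (h : ∀ x y, k (x - y) ≠ 0 → φ x = φ y) :
    ∫ q : ℚ_[p] × ℚ_[p], φ q.1 * k (q.1 - q.2) * φ q.2 ∂(μ.prod μ) =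
      (∫ x, φ x ^ 2 ∂μ) * ∫ z, k z ∂μ := by
  rw [integral_prod _ (hφ.integrable_mul_sub_mul hk), ← integral_mul_const]
  congr 1; ext x
  rw [← integral_sub_left_eq_self k μ x, ← integral_const_mul]
  congr 1; ext y
  by_cases hxy : k (x - y) = 0
  · simp [hxy]
  · rw [h x y hxy]; ring

omit [MeasurableSpace ℚ_[p]] [BorelSpace ℚ_[p]] in
theorem Padic.sum_indicator_norm_le_zpow {z : ℚ_[p]} {k N : ℤ} (hk : ‖z‖ = (p : ℝ) ^ k) (n : ℕ) :
    ∑ i ∈ Finset.range n, {z : ℚ_[p] | ‖z‖ ≤ (p : ℝ) ^ (N - 1 - i)}.indicator (1 : ℚ_[p] → ℝ) z =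
      (min n (N - k).toNat : ℕ) := by
  have hp : (1 : ℝ) < p := by exact_mod_cast (Fact.out : p.Prime).one_lt
  have : ∀ i : ℕ, {z : ℚ_[p] | ‖z‖ ≤ (p : ℝ) ^ (N - 1 - i)}.indicator (1 : ℚ_[p] → ℝ) z =
      if i < (N - k).toNat then 1 else 0 := by
    intro i
    have : ‖z‖ ≤ (p : ℝ) ^ (N - 1 - i) ↔ i < (N - k).toNat := by
      rw [hk, zpow_le_zpow_iff_right₀ hp]; lia
    simp only [indicator_apply, mem_ofPred_eq, this, Pi.one_apply]
  simp_rw [this, Finset.sum_boole]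
  congr 1
  rw [← Finset.card_range (min n _)]
  congr 1
  ext i
  simp

theorem IsTestFunction.exists_log_energy_le (hφ : IsTestFunction φ) (hφ0 : ∫ x, φ x ∂μ = 0) :
    Integrable (fun q : ℚ_[p] × ℚ_[p] => φ q.1 * Real.log ‖q.1 - q.2‖ * φ q.2) (μ.prod μ) ∧
    ∃ c > 0, ∫ q : ℚ_[p] × ℚ_[p], φ q.1 * Real.log ‖q.1 - q.2‖ * φ q.2 ∂(μ.prod μ) ≤
      -(c * ∫ x, φ x ^ 2 ∂μ) := by
  have hp : (1 : ℝ) < p := by exact_mod_cast (Fact.out : p.Prime).one_lt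
  have hp0 : (0 : ℝ) < p := one_pos.trans hp
  have hlog : 0 < Real.log p := Real.log_pos hp
  obtain ⟨N, hN⟩ := hφ.exists_norm_le_zpow
  obtain ⟨δ, hδ, hconst⟩ := hφ.exists_forall_norm_sub_lt
  obtain ⟨n, hn⟩ : ∃ n : ℕ, (p : ℝ) ^ (N - 1 - n) < δ := by
    obtain ⟨n, hn⟩ := pow_unbounded_of_one_lt ((p : ℝ) ^ (N - 1) / δ) hp
    refine ⟨n, ?_⟩
    rw [zpow_sub₀ hp0.ne', zpow_natCast, div_lt_iff₀ (by positivity)]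
    rwa [div_lt_iff₀ hδ, mul_comm] at hn
  let b : ℤ → ℚ_[p] → ℝ := fun j => {z : ℚ_[p] | ‖z‖ ≤ (p : ℝ) ^ j}.indicator 1
  have hb : ∀ j, Integrable (b j) μ := fun j => Padic.integrable_indicator_norm_le μ _
  let g : ℚ_[p] → ℝ := {z : ℚ_[p] | ‖z‖ ≤ (p : ℝ) ^ N}.indicator fun z => Real.log ‖z‖
  have hg : Integrable g μ := (integrable_indicator_iff (Padic.measurableSet_norm_le _)).2
    (Padic.integrableOn_log_norm μ N)
  have hsub : ∀ {x y}, φ x ≠ 0 → φ y ≠ 0 → ‖x - y‖ ≤ (p : ℝ) ^ N := fun {x y} hx hy =>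
    (Padic.norm_sub_le_max x y).trans (max_le (hN x hx) (hN y hy))
  have hkey : ∀ f f' : ℚ_[p] → ℝ, (∀ z, ‖z‖ ≤ (p : ℝ) ^ N → f z = f' z) →
      (fun q : ℚ_[p] × ℚ_[p] => φ q.1 * f (q.1 - q.2) * φ q.2) =
        fun q => φ q.1 * f' (q.1 - q.2) * φ q.2 := by
    intro f f' hff
    ext ⟨x, y⟩
    by_cases hx : φ x = 0
    · simp [hx]
    by_cases hy : φ y = 0
    · simp [hy]
    simp only [hff _ (hsub hx hy)]
  have hfg := hkey (fun z => Real.log ‖z‖) g fun z hz =>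
    (indicator_of_mem (s := {z | ‖z‖ ≤ (p : ℝ) ^ N}) hz fun z => Real.log ‖z‖).symm
  let S : ℚ_[p] → ℝ := fun z => ∑ i ∈ Finset.range (n + 1), b (N - 1 - i) z
  have hS : Integrable S μ := integrable_finsetSum _ fun i _ => hb _
  let h : ℚ_[p] → ℝ := fun z => g z - Real.log p * (N * b N z - S z)
  have hh : Integrable h μ := hg.sub ((((hb N).const_mul _).sub hS).const_mul _)
  have hform : ∀ {z : ℚ_[p]} {k : ℤ}, ‖z‖ = (p : ℝ) ^ k → k ≤ N →
      h z = Real.log p * (k - N + (min (n + 1) (N - k).toNat : ℕ)) := by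
    intro z k hk hkN
    have hz : ‖z‖ ≤ (p : ℝ) ^ N := by rwa [hk, zpow_le_zpow_iff_right₀ hp]
    have h1 : g z = k * Real.log p := by
      simp only [g]
      rw [indicator_of_mem (by exact hz), hk, Real.log_zpow]
    have h2 : b N z = 1 := indicator_of_mem (by exact hz) _
    have h3 : S z = _ := Padic.sum_indicator_norm_le_zpow hk (n + 1)
    simp only [h]
    rw [h1, h2, h3]
    ring
  have hout : ∀ {z : ℚ_[p]}, ¬ ‖z‖ ≤ (p : ℝ) ^ N → h z = 0 := by
    intro z hz
    have h1 : g z = 0 := indicator_of_notMem (s := {z | ‖z‖ ≤ (p : ℝ) ^ N}) hz _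
    have h2 : b N z = 0 := indicator_of_notMem (s := {z | ‖z‖ ≤ (p : ℝ) ^ N}) hz _
    have h3 : S z = 0 := Finset.sum_eq_zero fun i _ => indicator_of_notMem
      (s := {z | ‖z‖ ≤ (p : ℝ) ^ (N - 1 - i)}) (fun hz' => hz (le_trans hz' (zpow_le_zpow_right₀ hp.le (by lia)))) _
    simp [h, h1, h2, h3]
  have hsupp : ∀ z, h z ≠ 0 → ‖z‖ < δ := by
    intro z hz
    rcases eq_or_ne z 0 with rfl | hz0
    · simpa using hδ
    obtain ⟨k, hk⟩ := Padic.exists_norm_eq_zpow hz0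
    have hkN : k ≤ N := by
      by_contra hcon
      exact hz (hout (by rwa [hk, zpow_le_zpow_iff_right₀ hp]))
    by_contra hcon
    refine hz ?_
    have hkn : N - 1 - n < k := by
      rw [← zpow_lt_zpow_iff_right₀ hp, ← hk]
      exact hn.trans_le (not_lt.1 hcon)
    have hmin : ((min (n + 1) (N - k).toNat : ℕ) : ℤ) = N - k := by lia
    have hmin' : ((min (n + 1) (N - k).toNat : ℕ) : ℝ) = N - k := by exact_mod_cast hmin
    rw [hform hk hkN, hmin']
    ring
  have hh0 : ∫ z, h z ∂μ ≤ 0 := by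
    refine integral_nonpos_of_ae ?_
    filter_upwards [measure_eq_zero_iff_ae_notMem.1
      (measure_singleton (μ := μ) (0 : ℚ_[p]))] with z hz0
    obtain ⟨k, hk⟩ := Padic.exists_norm_eq_zpow hz0
    by_cases hkN : k ≤ N
    · rw [hform hk hkN]
      refine mul_nonpos_of_nonneg_of_nonpos hlog.le ?_
      have : ((min (n + 1) (N - k).toNat : ℕ) : ℤ) ≤ N - k := by lia
      have : ((min (n + 1) (N - k).toNat : ℕ) : ℝ) ≤ N - k := by exact_mod_cast this
      linarith
    · exact (hout (by rwa [hk, zpow_le_zpow_iff_right₀ hp])).le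
  let E : (ℚ_[p] → ℝ) → ℝ := fun f =>
    ∫ q : ℚ_[p] × ℚ_[p], φ q.1 * f (q.1 - q.2) * φ q.2 ∂(μ.prod μ)
  have hEh : E h = (∫ x, φ x ^ 2 ∂μ) * ∫ z, h z ∂μ :=
    hφ.integral_mul_sub_mul_of_support hh fun x y hxy => hconst x y (hsupp _ hxy)
  have hEb0 : E (b N) = 0 := by
    have h1 : E (b N) = ∫ q : ℚ_[p] × ℚ_[p], φ q.1 * φ q.2 ∂(μ.prod μ) := by
      simp only [E]
      rw [hkey (b N) 1 fun z hz => indicator_of_mem (s := {z | ‖z‖ ≤ (p : ℝ) ^ N}) hz _]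
      simp
    rw [h1, integral_prod_mul, hφ0, zero_mul]
  have hEb : ∀ j, 0 ≤ E (b j) := fun j => hφ.integral_indicator_nonneg (zpow_pos hp0 j)
  have hEbn : E (b (N - 1 - n)) = (∫ x, φ x ^ 2 ∂μ) * ∫ z, b (N - 1 - n) z ∂μ :=
    hφ.integral_mul_sub_mul_of_support (hb _) fun x y hxy =>
      hconst x y (lt_of_le_of_lt
        (mem_of_indicator_ne_zero (s := {z | ‖z‖ ≤ (p : ℝ) ^ (N - 1 - n)}) hxy) hn)
  have hES : E S = ∑ i ∈ Finset.range (n + 1), E (b (N - 1 - i)) := by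
    simp only [E]
    rw [← integral_finsetSum _ fun i _ => hφ.integrable_mul_sub_mul (hb _)]
    simp only [S, Finset.mul_sum, Finset.sum_mul]
  have hEg : E g = Real.log p * (N * E (b N) - E S) + E h := by
    have i1 := hφ.integrable_mul_sub_mul (hb N)
    have i2 := hφ.integrable_mul_sub_mul hS
    have i3 := hφ.integrable_mul_sub_mul hh
    simp only [E]
    rw [← integral_const_mul, ← integral_sub (i1.const_mul _) i2, ← integral_const_mul,
      ← integral_add]
    rotate_left
    · exact ((i1.const_mul _).sub i2).const_mul _
    · exact i3
    congr 1; ext q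
    simp only [h]
    ring
  have hI : 0 ≤ ∫ x, φ x ^ 2 ∂μ := integral_nonneg fun x => sq_nonneg _
  rw [hfg]
  refine ⟨hφ.integrable_mul_sub_mul hg, Real.log p * ∫ z, b (N - 1 - n) z ∂μ, ?_, ?_⟩
  · refine mul_pos hlog ?_
    simp only [b]
    rw [Padic.integral_indicator_norm_le]
    exact Padic.measureReal_norm_le_pos μ (zpow_pos hp0 _)
  · change E g ≤ _
    have h1 : E (b (N - 1 - n)) ≤ E S := by
      rw [hES]
      exact Finset.single_le_sum (f := fun i : ℕ => E (b (N - 1 - i))) (fun i _ => hEb _)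
        (Finset.mem_range.2 n.lt_succ_self)
    have h2 := mul_le_mul_of_nonneg_left h1 hlog.le
    have h3 := mul_nonpos_of_nonneg_of_nonpos hI hh0
    rw [hEbn] at h2
    rw [hEg, hEh, hEb0]
    linarith

theorem IsTestFunction.eq_zero_of_integral_sq_eq_zero (hφ : IsTestFunction φ)
    (h : ∫ x, φ x ^ 2 ∂μ = 0) (x : ℚ_[p]) : φ x = 0 := by
  have hcont : Continuous fun x => φ x ^ 2 := hφ.continuous.pow 2
  have hint : Integrable (fun x => φ x ^ 2) μ :=
    hcont.integrable_of_hasCompactSupport (hφ.2.comp_left (g := fun t : ℝ => t ^ 2) (by simp))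
  have h0 := (integral_eq_zero_iff_of_nonneg (fun x => sq_nonneg (φ x)) hint).1 h
  have h1 := (hcont.ae_eq_iff_eq μ continuous_zero).1 h0
  simpa using congrFun h1 x

end PadicLogEnergy

theorem stmt10 {p : ℕ} [Fact p.Prime] [MeasurableSpace ℚ_[p]] [BorelSpace ℚ_[p]]
    (μ : Measure ℚ_[p]) [μ.IsAddHaarMeasure]
    (hμ : μ {x : ℚ_[p] | ‖x‖ ≤ 1} = 1)
    (φ : ℚ_[p] → ℝ) (hφ : IsTestFunction φ) (hφ0 : ∫ x, φ x ∂μ = 0) :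
    Integrable (fun q : ℚ_[p] × ℚ_[p] => φ q.1 * Real.log ‖q.1 - q.2‖ * φ q.2) (μ.prod μ) ∧
    0 ≤ -(((p : ℝ) - 1) / ((p : ℝ) * Real.log p)) *
        ∫ x, (∫ y, φ x * Real.log ‖x - y‖ * φ y ∂μ) ∂μ ∧
    (-(((p : ℝ) - 1) / ((p : ℝ) * Real.log p)) *
        (∫ x, (∫ y, φ x * Real.log ‖x - y‖ * φ y ∂μ) ∂μ) = 0 ↔ ∀ x, φ x = 0) := by
  have hp : (1 : ℝ) < p := by exact_mod_cast (Fact.out : p.Prime).one_lt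
  have hlog : 0 < Real.log p := Real.log_pos hp
  obtain ⟨hint, c, hc, hle⟩ := hφ.exists_log_energy_le hφ0
  have hI : 0 ≤ ∫ x, φ x ^ 2 ∂μ := integral_nonneg fun x => sq_nonneg _
  have ha : 0 < ((p : ℝ) - 1) / ((p : ℝ) * Real.log p) :=
    div_pos (by linarith) (mul_pos (by linarith) hlog)
  refine ⟨hint, ?_⟩
  rw [← integral_prod _ hint]
  refine ⟨?_, fun h => ?_, fun h => by simp [h]⟩
  · have := mul_nonneg hc.le hI
    exact mul_nonneg_of_nonpos_of_nonpos (by linarith) (by linarith)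
  · refine hφ.eq_zero_of_integral_sq_eq_zero (μ := μ) ?_
    rcases mul_eq_zero.1 h with h | h
    · linarith
    · rw [h] at hle
      have : c * ∫ x, φ x ^ 2 ∂μ ≤ 0 := by linarith
      exact le_antisymm (nonpos_of_mul_nonpos_right this hc) hI
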